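/- arXiv:2509.04550 — 6 statements merged into one kernel-verified Lean document; each statement's English description precedes it below -/
import Mathlib

section
/- Let n, m, k be naturals with n ≤ m and k < m, and let μ and λ be partitions of n with μ ≻ λ (μ majorizes λ: for every t, the sum of the first t parts of μ is at least the sum of the first t parts of λ). Then: (i) if μ ≠ λ and F_{k,m}(μ) ≠ 0, then F_{k,m}(μ) > F_{k,m}(λ); and (ii) if F_{k,m}(μ) = 0, then F_{k,m}(λ) = 0. -/
/-- `F_{k,m}(μ) = ∏_{cells (i,j) of μ} (k + j - i)/(m + j - i)`. -/
noncomputable def Fkm (k m : ℕ) (μ : YoungDiagram) : ℝ :=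
  ∏ c ∈ μ.cells, (((k : ℝ) + c.2 - c.1) / ((m : ℝ) + c.2 - c.1))

/-- The partition `μ` majorizes the partition `lam`: for every `t`, the sum of the first
`t` parts (row lengths) of `μ` is at least that of `lam`. -/
def MajorizesYD (μ lam : YoungDiagram) : Prop :=
  ∀ t : ℕ, ∑ i ∈ Finset.range t, lam.rowLen i ≤ ∑ i ∈ Finset.range t, μ.rowLen i

theorem aux_convex (h : ℕ → ℝ) (hh : Monotone h) (a b : ℕ) :
    ∑ j ∈ Finset.range b, h j + ((a : ℝ) - b) * h b ≤ ∑ j ∈ Finset.range a, h j := by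
  rcases le_total b a with hab | hab
  · induction a, hab using Nat.le_induction with
    | base => simp
    | succ a hab ih =>
      rw [Finset.sum_range_succ _ a]
      have := hh hab
      push_cast
      linarith
  · induction b, hab using Nat.le_induction with
    | base => simp
    | succ b hab ih =>
      rw [Finset.sum_range_succ _ b]
      have h1 := hh (Nat.le_succ b)
      have h2 : (a : ℝ) ≤ b := by exact_mod_cast hab
      simp only [Nat.succ_eq_add_one] at h1
      push_cast
      nlinarith

theorem aux_abel (w d : ℕ → ℝ) (k : ℕ) (hw : ∀ i, i + 1 < k → w (i + 1) < w i)
    (hS : ∀ t, 0 ≤ ∑ i ∈ Finset.range t, d i) (t : ℕ) (ht : t < k) :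
    (∑ i ∈ Finset.range (t + 1), d i) * w t ≤ ∑ i ∈ Finset.range (t + 1), d i * w i ∧
    ((∃ s ≤ t, 0 < ∑ i ∈ Finset.range s, d i) →
      (∑ i ∈ Finset.range (t + 1), d i) * w t < ∑ i ∈ Finset.range (t + 1), d i * w i) := by
  induction t with
  | zero =>
    refine ⟨by simp, ?_⟩
    rintro ⟨s, hs, h⟩
    obtain rfl : s = 0 := by omega
    simp at h
  | succ t ih =>
    obtain ⟨h1, h2⟩ := ih (by omega)
    have hwt := hw t ht
    have hSt := hS (t + 1)
    rw [Finset.sum_range_succ _ (t + 1), Finset.sum_range_succ _ (t + 1)]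
    refine ⟨by nlinarith, ?_⟩
    rintro ⟨s, hs, h⟩
    rcases Nat.lt_or_ge t s with hts | hts
    · obtain rfl : s = t + 1 := by omega
      nlinarith
    · have := h2 ⟨s, hts, h⟩
      nlinarith

theorem aux_rows_zero (μ : YoungDiagram) (K : ℕ) (h : μ.rowLen K = 0) (c : ℕ × ℕ) :
    c ∈ μ.cells ↔ c.1 ∈ Finset.range K ∧ c.2 ∈ Finset.range (μ.rowLen c.1) := by
  rw [YoungDiagram.mem_cells, show c = (c.1, c.2) from rfl, YoungDiagram.mem_iff_lt_rowLen]
  simp only [Finset.mem_range]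
  refine ⟨fun hc => ⟨?_, hc⟩, fun hc => hc.2⟩
  by_contra hK
  have := μ.rowLen_anti K c.1 (by omega)
  omega

theorem aux_card (μ : YoungDiagram) (K : ℕ) (h : μ.rowLen K = 0) :
    μ.card = ∑ i ∈ Finset.range K, μ.rowLen i := by
  have := Finset.sum_finset_product μ.cells (Finset.range K)
    (fun i => Finset.range (μ.rowLen i)) (aux_rows_zero μ K h) (f := fun _ => 1)
  simpa using this

theorem aux_card_le (μ : YoungDiagram) (K : ℕ) :
    ∑ i ∈ Finset.range K, μ.rowLen i ≤ μ.card := by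
  have hz : μ.rowLen (K + μ.card) = 0 := by
    by_contra hne
    have hsub : (Finset.range (K + μ.card + 1)).image (fun i => (i, 0)) ⊆ μ.cells := by
      intro c hc
      simp only [Finset.mem_image, Finset.mem_range] at hc
      obtain ⟨i, hi, rfl⟩ := hc
      rw [YoungDiagram.mem_cells, YoungDiagram.mem_iff_lt_rowLen]
      have := μ.rowLen_anti i (K + μ.card) (by omega)
      omega
    have := Finset.card_le_card hsub
    rw [Finset.card_image_of_injective _ (fun a b h => by simpa using h)] at this
    simp at this
  rw [aux_card μ _ hz]
  exact Finset.sum_le_sum_of_subset (Finset.range_mono (by omega))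

theorem aux_zero (k m : ℕ) (μ : YoungDiagram) (h : μ.rowLen k ≠ 0) : Fkm k m μ = 0 := by
  apply Finset.prod_eq_zero (i := (k, 0))
  · rw [YoungDiagram.mem_cells, YoungDiagram.mem_iff_lt_rowLen]; omega
  · simp

theorem aux_factor_pos (k m : ℕ) (hkm : k < m) (μ : YoungDiagram) (h : μ.rowLen k = 0) 
    (c : ℕ × ℕ) (hc : c ∈ μ.cells) :
    0 < (((k : ℝ) + c.2 - c.1) / ((m : ℝ) + c.2 - c.1)) := by
  have h1 := ((aux_rows_zero μ k h c).1 hc).1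
  rw [Finset.mem_range] at h1
  have h2 : (c.1 : ℝ) < k := by exact_mod_cast h1
  have h3 : (k : ℝ) < m := by exact_mod_cast hkm
  have h4 : (0 : ℝ) ≤ c.2 := by positivity
  apply div_pos <;> linarith

theorem aux_log (k m : ℕ) (hkm : k < m) (μ : YoungDiagram) (h : μ.rowLen k = 0) :
    Real.log (Fkm k m μ) = ∑ i ∈ Finset.range k, ∑ j ∈ Finset.range (μ.rowLen i),
      Real.log (((k : ℝ) + j - i) / ((m : ℝ) + j - i)) := by
  unfold Fkm
  rw [Real.log_prod (fun c hc => (aux_factor_pos k m hkm μ h c hc).ne')]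
  exact Finset.sum_finset_product μ.cells (Finset.range k)
    (fun i => Finset.range (μ.rowLen i)) (aux_rows_zero μ k h)

theorem aux_mono (k m x y : ℝ) (hkm : k < m) (hx : 0 < k + x) (hxy : x < y) :
    Real.log ((k + x) / (m + x)) < Real.log ((k + y) / (m + y)) := by
  apply Real.log_lt_log
  · apply div_pos <;> linarith
  · rw [div_lt_div_iff₀ (by linarith) (by linarith)]
    nlinarith [mul_pos (sub_pos.2 hkm) (sub_pos.2 hxy)]

/-- Strict Schur convexity of `F_{k,m}` on partitions of `n` with respect to the
majorization order, wherever it is nonzero. -/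
theorem Fkm_strict_schur_convex
    (n m k : ℕ) (hnm : n ≤ m) (hkm : k < m)
    (μ lam : YoungDiagram) (hμ : μ.card = n) (hlam : lam.card = n)
    (hmaj : MajorizesYD μ lam) :
    (μ ≠ lam → Fkm k m μ ≠ 0 → Fkm k m lam < Fkm k m μ) ∧
    (Fkm k m μ = 0 → Fkm k m lam = 0) := by
  have hkm' : (k : ℝ) < m := by exact_mod_cast hkm
  have hpos : ∀ ν : YoungDiagram, ν.rowLen k = 0 → 0 < Fkm k m ν := fun ν h =>
    Finset.prod_pos (aux_factor_pos k m hkm ν h)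
  constructor
  · intro hne hF
    have hμk : μ.rowLen k = 0 := by
      by_contra h
      exact hF (aux_zero k m μ h)
    by_cases hlk : lam.rowLen k = 0
    swap
    · rw [aux_zero k m lam hlk]; exact hpos μ hμk
    rw [← Real.log_lt_log_iff (hpos _ hlk) (hpos _ hμk), aux_log k m hkm _ hlk,
      aux_log k m hkm _ hμk]
    -- weights
    set w : ℕ → ℝ := fun i => Real.log (((k : ℝ) + lam.rowLen i - i) / ((m : ℝ) + lam.rowLen i - i)) with hw
    set d : ℕ → ℝ := fun i => (μ.rowLen i : ℝ) - lam.rowLen i with hd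
    have hconv : ∀ i ∈ Finset.range k,
        ∑ j ∈ Finset.range (lam.rowLen i), Real.log (((k : ℝ) + j - i) / ((m : ℝ) + j - i))
          + d i * w i ≤
        ∑ j ∈ Finset.range (μ.rowLen i), Real.log (((k : ℝ) + j - i) / ((m : ℝ) + j - i)) := by
      intro i hi
      have hi' : (i : ℝ) < k := by exact_mod_cast Finset.mem_range.1 hi
      refine aux_convex (fun j => Real.log (((k : ℝ) + j - i) / ((m : ℝ) + j - i))) ?_ _ _
      refine monotone_nat_of_le_succ fun j => ?_
      have hj : (0 : ℝ) ≤ j := by positivity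
      have := aux_mono k m (j - i) ((j + 1 : ℕ) - i) hkm' (by linarith) (by push_cast; linarith)
      simp only [← add_sub_assoc] at this
      exact this.le
    have hwanti : ∀ i, i + 1 < k → w (i + 1) < w i := by
      intro i hi
      have hi' : (i : ℝ) + 1 < k := by exact_mod_cast hi
      have hr : (lam.rowLen (i + 1) : ℝ) ≤ lam.rowLen i := by
        exact_mod_cast lam.rowLen_anti i (i + 1) (by omega)
      have h0 : (0 : ℝ) ≤ lam.rowLen (i + 1) := by positivity
      have := aux_mono k m (lam.rowLen (i + 1) - (i + 1 : ℕ)) (lam.rowLen i - i) hkm'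
        (by push_cast; linarith) (by push_cast; linarith)
      simp only [← add_sub_assoc] at this
      exact this
    have hSd : ∀ t, ∑ i ∈ Finset.range t, d i =
        ((∑ i ∈ Finset.range t, μ.rowLen i : ℕ) : ℝ) - (∑ i ∈ Finset.range t, lam.rowLen i : ℕ) := by
      intro t
      simp [hd]
    have hS : ∀ t, 0 ≤ ∑ i ∈ Finset.range t, d i := by
      intro t
      rw [hSd, sub_nonneg]
      exact_mod_cast hmaj t
    have hSk : ∑ i ∈ Finset.range k, d i = 0 := by
      rw [hSd, ← aux_card μ k hμk, ← aux_card lam k hlk, hμ, hlam, sub_self]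
    have hex : ∃ s < k, 0 < ∑ i ∈ Finset.range s, d i := by
      by_contra hcon
      push Not at hcon
      have hz : ∀ s ≤ k, ∑ i ∈ Finset.range s, d i = 0 := by
        intro s hs
        rcases hs.lt_or_eq with h | h
        · exact le_antisymm (hcon s h) (hS s)
        · rw [h, hSk]
      apply hne
      have hrow : ∀ i, μ.rowLen i = lam.rowLen i := by
        intro i
        rcases Nat.lt_or_ge i k with h | h
        · have h1 := hz (i + 1) h
          rw [Finset.sum_range_succ, hz i h.le, zero_add] at h1
          have h2 : (μ.rowLen i : ℝ) = lam.rowLen i := sub_eq_zero.1 h1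
          exact_mod_cast h2
        · have h1 := μ.rowLen_anti k i h
          have h2 := lam.rowLen_anti k i h
          omega
      ext ⟨i, j⟩
      rw [YoungDiagram.mem_cells, YoungDiagram.mem_cells, YoungDiagram.mem_iff_lt_rowLen,
        YoungDiagram.mem_iff_lt_rowLen, hrow]
    obtain ⟨s, hs, hs0⟩ := hex
    obtain ⟨t, rfl⟩ : ∃ t, k = t + 1 := ⟨k - 1, by omega⟩
    have h1 := (aux_abel w d (t + 1) hwanti hS t (by omega)).2 ⟨s, by omega, hs0⟩
    rw [hSk, zero_mul] at h1
    have h2 := Finset.sum_le_sum hconv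
    rw [Finset.sum_add_distrib] at h2
    linarith
  · intro hF
    apply aux_zero
    intro hlk
    have hμk : μ.rowLen k ≠ 0 := fun h => (hpos μ h).ne' hF
    have h1 := hmaj k
    rw [← aux_card lam k hlk] at h1
    have h2 := aux_card_le μ (k + 1)
    rw [Finset.sum_range_succ] at h2
    omega
end

section
/- Let d be a natural number and let ε : Fin (d+1) → ℝ satisfy 0 ≤ ε_0 ≤ ε_1 ≤ … ≤ ε_d. For β ≥ 0 define the Gibbs probability vector α_β by (α_β)_i = exp(−β ε_i)/∑_{j=0}^{d} exp(−β ε_j). If β ≥ β′ ≥ 0, then α_β majorizes α_{β′}; concretely, since the entries of α_β are already nonincreasing in i, for every k ∈ {0,…,d} one has ∑_{i=0}^{k} exp(−β ε_i)/∑_{j=0}^{d} exp(−β ε_j) ≥ ∑_{i=0}^{k} exp(−β′ ε_i)/∑_{j=0}^{d} exp(−β′ ε_j). -/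
/-- Gibbs distributions at higher inverse temperature majorize those at lower inverse
temperature: since the energies `ε` are nondecreasing, the entries of the Gibbs vector
are nonincreasing, and the top-`(k+1)` partial sums are monotone in `β`. -/
theorem gibbs_majorization
    (d : ℕ) (ε : Fin (d + 1) → ℝ) (hε0 : 0 ≤ ε 0) (hmono : Monotone ε)
    (β β' : ℝ) (hβ' : 0 ≤ β') (hββ : β' ≤ β) (k : ℕ) (hk : k ≤ d) :
    (∑ i ∈ Finset.univ.filter (fun i : Fin (d + 1) => (i : ℕ) ≤ k), Real.exp (-β' * ε i)) /
        (∑ j : Fin (d + 1), Real.exp (-β' * ε j))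
      ≤ (∑ i ∈ Finset.univ.filter (fun i : Fin (d + 1) => (i : ℕ) ≤ k), Real.exp (-β * ε i)) /
        (∑ j : Fin (d + 1), Real.exp (-β * ε j)) := by
  have hpos : ∀ b : ℝ, 0 < ∑ j : Fin (d + 1), Real.exp (-b * ε j) := fun b =>
    Finset.sum_pos (fun _ _ => Real.exp_pos _) Finset.univ_nonempty
  rw [div_le_div_iff₀ (hpos β') (hpos β)]
  rw [← Finset.sum_filter_add_sum_filter_not Finset.univ
      (fun i : Fin (d + 1) => (i : ℕ) ≤ k) (fun j => Real.exp (-β * ε j)),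
    ← Finset.sum_filter_add_sum_filter_not Finset.univ
      (fun i : Fin (d + 1) => (i : ℕ) ≤ k) (fun j => Real.exp (-β' * ε j))]
  have key : (∑ i ∈ Finset.univ.filter (fun i : Fin (d + 1) => (i : ℕ) ≤ k),
        Real.exp (-β' * ε i)) *
      (∑ i ∈ Finset.univ.filter (fun i : Fin (d + 1) => ¬ (i : ℕ) ≤ k), Real.exp (-β * ε i))
      ≤ (∑ i ∈ Finset.univ.filter (fun i : Fin (d + 1) => (i : ℕ) ≤ k),
        Real.exp (-β * ε i)) *
      (∑ i ∈ Finset.univ.filter (fun i : Fin (d + 1) => ¬ (i : ℕ) ≤ k),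
        Real.exp (-β' * ε i)) := by
    rw [Finset.sum_mul_sum, Finset.sum_mul_sum]
    refine Finset.sum_le_sum fun i hi => Finset.sum_le_sum fun j hj => ?_
    rw [← Real.exp_add, ← Real.exp_add, Real.exp_le_exp]
    have h1 := (Finset.mem_filter.mp hi).2
    have h2 := (Finset.mem_filter.mp hj).2
    have hij : ε i ≤ ε j := hmono (Fin.le_def.mpr (by omega))
    nlinarith [mul_nonneg (sub_nonneg.mpr hββ) (sub_nonneg.mpr hij)]
  linarith
end

section
/- Let d be a natural number, let ε : Fin (d+1) → ℝ satisfy 0 ≤ ε_0 ≤ ε_1 ≤ … ≤ ε_d, let k ∈ {0,…,d}, and let β ∈ ℝ. Then (∑_{i=0}^{k} ε_i · exp(−β ε_i)) / (∑_{i=0}^{k} exp(−β ε_i)) ≤ (∑_{j=0}^{d} ε_j · exp(−β ε_j)) / (∑_{j=0}^{d} exp(−β ε_j)); equivalently, ∑_{j=0}^{d} ∑_{i=0}^{k} (ε_j − ε_i) · exp(−β(ε_i + ε_j)) ≥ 0. -/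
/-- The thermal expected energy of the truncated energy list `ε_0, …, ε_k` at inverse
temperature `β` is at most that of the full list `ε_0, …, ε_d`. -/
theorem truncated_expected_energy_le
    (d : ℕ) (ε : Fin (d + 1) → ℝ) (hε0 : 0 ≤ ε 0) (hmono : Monotone ε)
    (k : ℕ) (hk : k ≤ d) (β : ℝ) :
    (∑ i ∈ Finset.univ.filter (fun i : Fin (d + 1) => (i : ℕ) ≤ k), ε i * Real.exp (-β * ε i)) /
        (∑ i ∈ Finset.univ.filter (fun i : Fin (d + 1) => (i : ℕ) ≤ k), Real.exp (-β * ε i))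
      ≤ (∑ j : Fin (d + 1), ε j * Real.exp (-β * ε j)) /
        (∑ j : Fin (d + 1), Real.exp (-β * ε j)) := by
  have hA : (∑ i ∈ Finset.univ.filter (fun i : Fin (d + 1) => (i : ℕ) ≤ k),
      ε i * Real.exp (-β * ε i)) ≤ ε ⟨k, by omega⟩ *
      ∑ i ∈ Finset.univ.filter (fun i : Fin (d + 1) => (i : ℕ) ≤ k), Real.exp (-β * ε i) := by
    rw [Finset.mul_sum]
    refine Finset.sum_le_sum fun i hi => ?_
    have h : (i : ℕ) ≤ k := (Finset.mem_filter.mp hi).2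
    exact mul_le_mul_of_nonneg_right (hmono (Fin.le_def.mpr h)) (Real.exp_pos _).le
  have hB : ε ⟨k, by omega⟩ *
      (∑ i ∈ Finset.univ.filter (fun i : Fin (d + 1) => ¬ (i : ℕ) ≤ k), Real.exp (-β * ε i)) ≤
      ∑ i ∈ Finset.univ.filter (fun i : Fin (d + 1) => ¬ (i : ℕ) ≤ k),
      ε i * Real.exp (-β * ε i) := by
    rw [Finset.mul_sum]
    refine Finset.sum_le_sum fun i hi => ?_
    have h : ¬ (i : ℕ) ≤ k := (Finset.mem_filter.mp hi).2
    exact mul_le_mul_of_nonneg_right (hmono (Fin.le_def.mpr (not_le.mp h).le)) (Real.exp_pos _).le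
  have hZl : 0 < ∑ i ∈ Finset.univ.filter (fun i : Fin (d + 1) => (i : ℕ) ≤ k),
      Real.exp (-β * ε i) :=
    Finset.sum_pos (fun i _ => Real.exp_pos _) ⟨0, by simp⟩
  have hZh : 0 ≤ ∑ i ∈ Finset.univ.filter (fun i : Fin (d + 1) => ¬ (i : ℕ) ≤ k),
      Real.exp (-β * ε i) :=
    Finset.sum_nonneg (fun i _ => (Real.exp_pos _).le)
  rw [← Finset.sum_filter_add_sum_filter_not Finset.univ (fun i : Fin (d + 1) => (i : ℕ) ≤ k)
      (fun j => ε j * Real.exp (-β * ε j)),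
    ← Finset.sum_filter_add_sum_filter_not Finset.univ (fun i : Fin (d + 1) => (i : ℕ) ≤ k)
      (fun j => Real.exp (-β * ε j))]
  rw [div_le_div_iff₀ hZl (by linarith)]
  have h1 := mul_le_mul_of_nonneg_right hA hZh
  have h2 := mul_le_mul_of_nonneg_right hB hZl.le
  linarith
end

section
/- Let n ≥ 1 and let N be an n×n complex matrix such that N is positive semidefinite and 1 − N is positive semidefinite (where 1 is the identity matrix). Then there exists a unitary matrix U indexed by Fin n ⊕ Fin n (i.e., a 2n×2n unitary) such that for all x, y : Fin n, ∑_{s : Fin n} conj(U_{(inl s),(inl x)}) · U_{(inl s),(inl y)} = N_{x,y}; that is, the Gram matrix formed from the upper-left n×n block of U, summing over the first n rows, equals N. -/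
open ComplexOrder

open scoped MatrixOrder in
theorem sqrt_aux {n : ℕ} (N : Matrix (Fin n) (Fin n) ℂ)
    (hN : N.PosSemidef) (hN1 : (1 - N).PosSemidef) :
    ∃ A B : Matrix (Fin n) (Fin n) ℂ, A.conjTranspose = A ∧ B.conjTranspose = B ∧
      A * A = N ∧ B * B = 1 - N ∧ A * B = B * A := by
  refine ⟨CFC.sqrt N, CFC.sqrt (1 - N), (Matrix.nonneg_iff_posSemidef.mp (CFC.sqrt_nonneg N)).1,
    (Matrix.nonneg_iff_posSemidef.mp (CFC.sqrt_nonneg (1 - N))).1, CFC.sqrt_mul_sqrt_self _ hN.nonneg,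
    CFC.sqrt_mul_sqrt_self _ hN1.nonneg, ?_⟩
  have h0 : Commute N (1 - N) := (Commute.one_right N).sub_right (Commute.refl N)
  have h1 : Commute (CFC.sqrt N) (1 - N) := Commute.cfcₙ_nnreal h0 _
  exact (Commute.cfcₙ_nnreal h1.symm _).symm

/-- Any `n × n` complex matrix `N` with `0 ≤ N ≤ 1` in the Loewner order arises as the
Gram matrix of the first `n` columns of a `2n × 2n` unitary, summing over the first `n`
rows. -/
theorem exists_unitary_gram_block
    (n : ℕ) (hn : 1 ≤ n) (N : Matrix (Fin n) (Fin n) ℂ)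
    (hN : N.PosSemidef) (hN1 : (1 - N).PosSemidef) :
    ∃ U : Matrix (Fin n ⊕ Fin n) (Fin n ⊕ Fin n) ℂ,
      U ∈ Matrix.unitaryGroup (Fin n ⊕ Fin n) ℂ ∧
      ∀ x y : Fin n,
        ∑ s : Fin n, (starRingEnd ℂ) (U (Sum.inl s) (Sum.inl x)) * U (Sum.inl s) (Sum.inl y)
          = N x y := by
  obtain ⟨A, B, hA, hB, hAA, hBB, hAB⟩ := sqrt_aux N hN hN1
  refine ⟨Matrix.fromBlocks A B B (-A), ?_, ?_⟩
  · rw [Matrix.mem_unitaryGroup_iff, Matrix.star_eq_conjTranspose,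
      Matrix.fromBlocks_conjTranspose, Matrix.fromBlocks_multiply, Matrix.conjTranspose_neg,
      hA, hB, ← Matrix.fromBlocks_one]
    simp [hAA, hBB, hAB]
  · intro x y
    have h : (A.conjTranspose * A) x y = N x y := by rw [hA, hAA]
    simpa [Matrix.mul_apply] using h
end

section
/- Let n and L be naturals, let σ be a permutation of Fin n, and let α : Fin L → ℂ. Then ∑_{j} ∏_{x : Fin n} α(j(x)) = (∑_{i : Fin L} α(i))^{F(σ)} · ∏_{l ∈ cycleType(σ)} (∑_{i : Fin L} α(i)^l), where the sum on the left runs over all functions j : Fin n → Fin L satisfying j ∘ σ = j, F(σ) is the number of fixed points of σ, and cycleType(σ) is the multiset of lengths (each ≥ 2) of the nontrivial cycles of σ. -/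
open Equiv Equiv.Perm in
/-- Index of the cycle (possibly trivial) containing a point. -/
noncomputable def cycIdx {n : ℕ} (σ : Perm (Fin n)) (x : Fin n) :
    {x : Fin n // σ x = x} ⊕ {c // c ∈ σ.cycleFactorsFinset} :=
  if h : σ x = x then Sum.inl ⟨x, h⟩
  else Sum.inr ⟨σ.cycleOf x, cycleOf_mem_cycleFactorsFinset_iff.2 (mem_support.2 h)⟩

open Equiv Equiv.Perm in
theorem cycIdx_inl {n : ℕ} (σ : Perm (Fin n)) (x : Fin n) (a : {x : Fin n // σ x = x}) :
    cycIdx σ x = Sum.inl a ↔ x = a.1 := by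
  obtain ⟨a, ha⟩ := a
  unfold cycIdx
  split_ifs with h
  · simp
  · simp only [reduceCtorEq, false_iff]
    rintro rfl
    exact h ha

open Equiv Equiv.Perm in
theorem cycIdx_inr {n : ℕ} (σ : Perm (Fin n)) (x : Fin n) (c : {c // c ∈ σ.cycleFactorsFinset}) :
    cycIdx σ x = Sum.inr c ↔ x ∈ c.1.support := by
  obtain ⟨c, hc⟩ := c
  unfold cycIdx
  split_ifs with h
  · simp only [reduceCtorEq, false_iff]
    intro hx
    exact mem_support.1 (mem_cycleFactorsFinset_support_le hc hx) h
  · simp only [Sum.inr.injEq, Subtype.mk.injEq]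
    constructor
    · rintro rfl
      exact mem_support_cycleOf_iff.2 ⟨SameCycle.refl _ _, mem_support.2 h⟩
    · intro hx
      exact (cycle_is_cycleOf hx hc).symm

open Equiv Equiv.Perm in
theorem cycIdx_surj {n : ℕ} (σ : Perm (Fin n)) : Function.Surjective (cycIdx σ) := by
  rintro (a | c)
  · exact ⟨a.1, (cycIdx_inl _ _ _).2 rfl⟩
  · obtain ⟨x, hx⟩ := (mem_cycleFactorsFinset_iff.1 c.2).1.nonempty_support
    exact ⟨x, (cycIdx_inr _ _ _).2 hx⟩

open Equiv Equiv.Perm in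
theorem cycIdx_apply {n : ℕ} (σ : Perm (Fin n)) (x : Fin n) : cycIdx σ (σ x) = cycIdx σ x := by
  by_cases h : σ x = x
  · rw [h]
  · have h2 : ¬ σ (σ x) = σ x := fun h' => h (σ.injective h')
    rw [cycIdx, cycIdx, dif_neg h, dif_neg h2]
    congr 2
    exact (SameCycle.cycleOf_eq (sameCycle_apply_right.2 (SameCycle.refl _ _))).symm

open Equiv Equiv.Perm in
theorem inv_of_cycIdx {n L : ℕ} (σ : Perm (Fin n)) (j : Fin n → Fin L) (hj : j ∘ σ = j)
    (x y : Fin n) (h : cycIdx σ x = cycIdx σ y) : j x = j y := by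
  have key : SameCycle σ x y := by
    rcases hy : cycIdx σ y with a | c
    · rw [hy] at h
      rw [(cycIdx_inl _ _ _).1 h, (cycIdx_inl _ _ _).1 hy]
    · rw [hy] at h
      have h1 := (cycIdx_inr _ _ _).1 h
      have h2 := (cycIdx_inr _ _ _).1 hy
      rw [cycle_is_cycleOf h1 c.2] at h2
      exact (mem_support_cycleOf_iff.1 h2).1
  obtain ⟨k, hk⟩ := key.exists_nat_pow_eq
  rw [← hk]
  clear hk h key
  induction k with
  | zero => rfl
  | succ k ih =>
    rw [ih, pow_succ', Perm.mul_apply]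
    exact (congrFun hj _).symm

/-- Summing `∏_x α(j x)` over functions `j : Fin n → Fin L` invariant under a permutation
`σ` (i.e. `j ∘ σ = j`) yields the power-sum symmetric polynomial of the cycle type of `σ`:
a factor `∑ i, α i` for each fixed point and a factor `∑ i, (α i)^l` for each cycle of
length `l ≥ 2`. -/
theorem sum_sigma_invariant_eq_powerSum
    (n L : ℕ) (σ : Equiv.Perm (Fin n)) (α : Fin L → ℂ) :
    ∑ j ∈ Finset.univ.filter (fun j : Fin n → Fin L => j ∘ σ = j), ∏ x, α (j x)
      = (∑ i, α i) ^ (Finset.univ.filter (fun x : Fin n => σ x = x)).card *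
        (σ.cycleType.map (fun l => ∑ i, α i ^ l)).prod := by
  classical
  have h1 : ∑ j ∈ Finset.univ.filter (fun j : Fin n → Fin L => j ∘ σ = j), ∏ x, α (j x)
      = ∑ g : ({x : Fin n // σ x = x} ⊕ {c // c ∈ σ.cycleFactorsFinset}) → Fin L,
          ∏ x, α (g (cycIdx σ x)) := by
    symm
    refine Finset.sum_bij (fun g _ => g ∘ cycIdx σ) ?_ ?_ ?_ ?_
    · intro g _
      simp only [Finset.mem_filter, Finset.mem_univ, true_and]
      funext x
      simp [cycIdx_apply]
    · intro g _ g' _ h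
      exact (cycIdx_surj σ).injective_comp_right h
    · intro j hj
      have hj := (Finset.mem_filter.1 hj).2
      refine ⟨fun q => j (Function.surjInv (cycIdx_surj σ) q), Finset.mem_univ _, ?_⟩
      funext x
      exact inv_of_cycIdx σ j hj _ _ (Function.surjInv_eq (cycIdx_surj σ) _)
    · intro g _
      rfl
  have h2 : ∀ g : ({x : Fin n // σ x = x} ⊕ {c // c ∈ σ.cycleFactorsFinset}) → Fin L,
      ∏ x, α (g (cycIdx σ x)) =
        ∏ q, α (g q) ^ (Finset.univ.filter (fun x => cycIdx σ x = q)).card := by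
    intro g
    rw [← Finset.prod_fiberwise' Finset.univ (cycIdx σ) (fun q => α (g q))]
    simp
  rw [h1, Finset.sum_congr rfl (fun g _ => h2 g)]
  rw [← Fintype.prod_sum (fun q i => α i ^ (Finset.univ.filter (fun x => cycIdx σ x = q)).card)]
  rw [Fintype.prod_sum_type]
  simp only [cycIdx_inl, cycIdx_inr]
  congr 1
  · simp [Finset.filter_eq', Fintype.card_subtype]
  · rw [Equiv.Perm.cycleType_def, Multiset.map_map]
    simp only [Finset.filter_mem_eq_inter, Finset.univ_inter, Finset.univ_eq_attach]
    exact Finset.prod_attach σ.cycleFactorsFinset (fun c => ∑ i, α i ^ c.support.card)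
end

section
/- Let Q be a finite type. Let N be a natural number and λ : Fin N → ℕ with ∑_x λ(x) = card Q. For each x : Fin N, let M(x) be a natural number and ν_x : Fin (M(x)) → ℕ with ∑_y ν_x(y) = λ(x). Let R be a commutative ring and f : Finset Q → R any function. For a finset q ⊆ Q and a size vector s : ι → ℕ (ι a finite type) with ∑ s = card q, call an 'ordered partition of q with sizes s' a function P : ι → Finset Q such that the P(i) are pairwise disjoint, their union is q, and card(P(i)) = s(i) for all i. Then ∑_{R'} ∏_{x : Fin N} ( ∑_{P_x} ∏_{y : Fin (M(x))} f(P_x(y)) ) = ∑_{P} ∏_{(x,y) : Σ x, Fin (M(x))} f(P(x,y)), where R' ranges over ordered partitions of the full finset of Q with sizes λ, for each x the inner sum ranges over ordered partitions of R'(x) with sizes ν_x, and on the right P ranges over ordered partitions of the full finset of Q with sizes ν : (Σ x, Fin (M(x))) → ℕ given by ν(x,y) = ν_x(y). -/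
/-- The ordered partitions of the finset `q` with block sizes `s`: functions
`P : ι → Finset Q` with pairwise disjoint values whose union is `q` and with
`card (P i) = s i` for all `i`. -/
def orderedPartitions {Q : Type*} [Fintype Q] [DecidableEq Q]
    {ι : Type*} [Fintype ι] [DecidableEq ι] (q : Finset Q) (s : ι → ℕ) :
    Finset (ι → Finset Q) :=
  Finset.univ.filter (fun P =>
    (∀ i j, i ≠ j → Disjoint (P i) (P j)) ∧
    Finset.univ.biUnion P = q ∧
    ∀ i, (P i).card = s i)

/-- Re-summation identity for refining ordered set partitions: choosing an ordered
partition of `Q` with block sizes `λ` and then an ordered partition of each block with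
sizes `ν_x` is the same as choosing a single ordered partition with the concatenated
size vector `ν`. -/
theorem sum_orderedPartitions_refine
    {Q : Type*} [Fintype Q] [DecidableEq Q]
    (N : ℕ) (lam : Fin N → ℕ) (hlam : ∑ x, lam x = Fintype.card Q)
    (M : Fin N → ℕ) (ν : (x : Fin N) → Fin (M x) → ℕ)
    (hν : ∀ x, ∑ y, ν x y = lam x)
    {R : Type*} [CommRing R] (f : Finset Q → R) :
    ∑ R' ∈ orderedPartitions (Finset.univ : Finset Q) lam,
        ∏ x : Fin N, ∑ Px ∈ orderedPartitions (R' x) (ν x), ∏ y, f (Px y)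
      = ∑ P ∈ orderedPartitions (Finset.univ : Finset Q)
            (fun p : Σ x : Fin N, Fin (M x) => ν p.1 p.2),
          ∏ p : Σ x : Fin N, Fin (M x), f (P p) := by
  simp_rw [Finset.prod_univ_sum]
  rw [Finset.sum_sigma']
  refine Finset.sum_bij'
    (fun a _ => fun p : Σ x : Fin N, Fin (M x) => a.2 p.1 p.2)
    (fun P _ => ⟨fun x => Finset.univ.biUnion fun y => P ⟨x, y⟩, fun x y => P ⟨x, y⟩⟩)
    ?_ ?_ ?_ ?_ ?_
  · rintro ⟨R', P⟩ h
    simp only [Finset.mem_sigma, Fintype.mem_piFinset, orderedPartitions, Finset.mem_filter,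
      Finset.mem_univ, true_and] at h ⊢
    obtain ⟨⟨hd, hu, hc⟩, hP⟩ := h
    have hsub : ∀ x y, P x y ⊆ R' x := by
      intro x y
      rw [← (hP x).2.1]
      exact Finset.subset_biUnion_of_mem (P x) (Finset.mem_univ y)
    refine ⟨?_, ?_, fun p => (hP p.1).2.2 p.2⟩
    · rintro ⟨x, y⟩ ⟨x', y'⟩ hne
      by_cases hx : x = x'
      · subst hx
        exact (hP x).1 y y' (fun e => hne (by rw [e]))
      · exact (hd x x' hx).mono (hsub x y) (hsub x' y')
    · ext a
      simp only [Finset.mem_biUnion, Finset.mem_univ, true_and, iff_true]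
      have ha : a ∈ Finset.univ.biUnion R' := by rw [hu]; exact Finset.mem_univ a
      obtain ⟨x, -, hx⟩ := Finset.mem_biUnion.1 ha
      rw [← (hP x).2.1] at hx
      obtain ⟨y, -, hy⟩ := Finset.mem_biUnion.1 hx
      exact ⟨⟨x, y⟩, hy⟩
  · intro P h
    simp only [Finset.mem_sigma, Fintype.mem_piFinset, orderedPartitions, Finset.mem_filter,
      Finset.mem_univ, true_and] at h ⊢
    obtain ⟨hd, hu, hc⟩ := h
    have hdx : ∀ x, ∀ y y' : Fin (M x), y ≠ y' → Disjoint (P ⟨x, y⟩) (P ⟨x, y'⟩) := by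
      intro x y y' hne
      exact hd _ _ (fun e => hne (by simpa using e))
    refine ⟨⟨?_, ?_, ?_⟩, fun x => ⟨hdx x, fun y => hc ⟨x, y⟩⟩⟩
    · intro x x' hne
      simp only [Finset.disjoint_biUnion_left, Finset.disjoint_biUnion_right]
      intro y _ y' _
      exact hd _ _ (fun e => hne (congrArg Sigma.fst e))
    · ext a
      simp only [Finset.mem_biUnion, Finset.mem_univ, true_and, iff_true]
      have ha : a ∈ Finset.univ.biUnion P := by rw [hu]; exact Finset.mem_univ a
      obtain ⟨⟨x, y⟩, -, hx⟩ := Finset.mem_biUnion.1 ha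
      exact ⟨x, y, hx⟩
    · intro x
      rw [Finset.card_biUnion (fun y _ y' _ hne => hdx x y y' hne), ← hν x]
      exact Finset.sum_congr rfl fun y _ => hc ⟨x, y⟩
  · rintro ⟨R', P⟩ h
    simp only [Finset.mem_sigma, Fintype.mem_piFinset, orderedPartitions, Finset.mem_filter,
      Finset.mem_univ, true_and] at h
    have : (fun x => Finset.univ.biUnion fun y => P x y) = R' := funext fun x => (h.2 x).2.1
    simp [this]
  · intro P _
    rfl
  · rintro ⟨R', P⟩ _
    rw [Fintype.prod_sigma]
end
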